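/- arXiv:1202.2115 — 2 statements merged into one kernel-verified Lean document; each statement's English description precedes it below -/
import Mathlib

section
/- Let a > 0, let n be an odd positive integer, and let k, λ be real with λ ≠ 0. Then (1/(2π))·|∫_{-a/2}^{a/2} √(2/a)·cos(nπx/a)·exp(-i·(k - iλ)·x) dx|² = 4π n²·(cos²(ka/2)·cosh²(λa/2) + sin²(ka/2)·sinh²(λa/2)) / (a³·((k² − λ² − π²n²/a²)² + 4λ²k²)). -/
open Real Complex

lemma aux_integral (p K : ℂ) (h : p ^ 2 - K ^ 2 ≠ 0) (b : ℝ) (hc : Complex.cos (p * b) = 0) :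
    ∫ x in (-b)..b, Complex.cos (p * x) * Complex.exp (-Complex.I * K * x) =
      2 * p * Complex.sin (p * b) * Complex.cos (K * b) / (p ^ 2 - K ^ 2) := by
  have hd : ∀ x : ℝ, HasDerivAt (fun x : ℝ => Complex.exp (-Complex.I * K * x) *
      (p * Complex.sin (p * x) - Complex.I * K * Complex.cos (p * x)) / (p ^ 2 - K ^ 2))
      (Complex.cos (p * x) * Complex.exp (-Complex.I * K * x)) x := by
    intro x
    have e1 : HasDerivAt (fun z : ℂ => -Complex.I * K * z) (-Complex.I * K) (x : ℂ) := by
      simpa using (hasDerivAt_id (x : ℂ)).const_mul (-Complex.I * K)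
    have e2 : HasDerivAt (fun z : ℂ => p * z) p (x : ℂ) := by
      simpa using (hasDerivAt_id (x : ℂ)).const_mul p
    have := ((e1.cexp.mul ((e2.csin.const_mul p).sub
      (e2.ccos.const_mul (Complex.I * K)))).div_const (p ^ 2 - K ^ 2)).comp_ofReal
    refine this.congr_deriv ?_
    rw [div_eq_iff h, Pi.sub_apply]
    linear_combination (Complex.cos (p * x) * Complex.exp (-Complex.I * K * x) * K ^ 2) * Complex.I_sq
  rw [intervalIntegral.integral_eq_sub_of_hasDerivAt (fun x _ => hd x)
    (Continuous.intervalIntegrable (by fun_prop) _ _)]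
  have h2 : 2 * Complex.cos (K * b) = Complex.exp (-Complex.I * K * b) + Complex.exp (Complex.I * K * b) := by
    rw [Complex.two_cos]
    rw [add_comm]
    congr 2 <;> ring
  have h3 : -Complex.I * K * ((-b : ℝ) : ℂ) = Complex.I * K * b := by push_cast; ring
  have h4 : p * ((-b : ℝ) : ℂ) = -(p * b) := by push_cast; ring
  rw [h3, h4, Complex.sin_neg, Complex.cos_neg, hc, ← sub_div]
  congr 1
  linear_combination (-p * Complex.sin (p * b)) * h2

theorem stmt_13 (a : ℝ) (ha : 0 < a) (n : ℕ) (hn : 0 < n) (hodd : Odd n)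
    (k lam : ℝ) (hlam : lam ≠ 0) :
    1 / (2 * π) *
      norm (∫ x in (-(a / 2))..(a / 2),
        ((Real.sqrt (2 / a) * Real.cos (n * π * x / a) : ℝ) : ℂ) *
          Complex.exp (-Complex.I * ((k : ℂ) - Complex.I * lam) * x)) ^ 2 =
    4 * π * n ^ 2 *
        (Real.cos (k * a / 2) ^ 2 * Real.cosh (lam * a / 2) ^ 2 +
          Real.sin (k * a / 2) ^ 2 * Real.sinh (lam * a / 2) ^ 2) /
      (a ^ 3 * ((k ^ 2 - lam ^ 2 - π ^ 2 * n ^ 2 / a ^ 2) ^ 2 + 4 * lam ^ 2 * k ^ 2)) := by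
  obtain ⟨p, hp⟩ : ∃ p : ℝ, p = n * π / a := ⟨_, rfl⟩
  have hn' : (0 : ℝ) < n := by exact_mod_cast hn
  have hp0 : 0 < p := by rw [hp]; positivity
  have hD : 0 < (k ^ 2 - lam ^ 2 - p ^ 2) ^ 2 + 4 * lam ^ 2 * k ^ 2 := by
    by_cases hk : k = 0
    · subst hk
      have : 0 < lam ^ 2 + p ^ 2 := by positivity
      nlinarith [pow_pos this 2]
    · positivity
  have hDc : ((p : ℂ) ^ 2 - ((k : ℂ) - Complex.I * lam) ^ 2) =
      ((p ^ 2 - k ^ 2 + lam ^ 2 : ℝ) : ℂ) + ((2 * k * lam : ℝ) : ℂ) * Complex.I := by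
    push_cast
    linear_combination (-(lam : ℂ) ^ 2) * Complex.I_sq
  have hDn : norm ((p : ℂ) ^ 2 - ((k : ℂ) - Complex.I * lam) ^ 2) ^ 2 =
      (k ^ 2 - lam ^ 2 - p ^ 2) ^ 2 + 4 * lam ^ 2 * k ^ 2 := by
    rw [hDc, ← Complex.normSq_eq_norm_sq, Complex.normSq_add_mul_I]; ring
  have hne : ((p : ℂ) ^ 2 - ((k : ℂ) - Complex.I * lam) ^ 2) ≠ 0 := by
    intro h0
    rw [h0] at hDn
    simp at hDn
    linarith
  have hcr : Real.cos (p * (a / 2)) = 0 := by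
    obtain ⟨m, hm⟩ := hodd
    rw [Real.cos_eq_zero_iff]
    refine ⟨m, ?_⟩
    rw [hp, hm]; push_cast; field_simp
  have hs : Real.sin (p * (a / 2)) ^ 2 = 1 := by
    have := Real.sin_sq_add_cos_sq (p * (a / 2))
    rw [hcr] at this; linarith
  have hI := aux_integral p ((k : ℂ) - Complex.I * lam) hne (a / 2)
    (by exact_mod_cast congrArg (fun x : ℝ => (x : ℂ)) hcr)
  have hC : norm (Complex.cos (((k : ℂ) - Complex.I * lam) * ((a / 2 : ℝ) : ℂ))) ^ 2 =
      Real.cos (k * a / 2) ^ 2 * Real.cosh (lam * a / 2) ^ 2 +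
          Real.sin (k * a / 2) ^ 2 * Real.sinh (lam * a / 2) ^ 2 := by
    have : ((k : ℂ) - Complex.I * lam) * ((a / 2 : ℝ) : ℂ) =
      ((k * a / 2 : ℝ) : ℂ) - ((lam * a / 2 : ℝ) : ℂ) * Complex.I := by push_cast; ring
    rw [this, Complex.cos_sub, Complex.cos_mul_I, Complex.sin_mul_I, ← mul_assoc,
      ← Complex.ofReal_cos, ← Complex.ofReal_sin, ← Complex.ofReal_cosh, ← Complex.ofReal_sinh,
      ← Complex.ofReal_mul, ← Complex.ofReal_mul, ← Complex.normSq_eq_norm_sq,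
      Complex.normSq_add_mul_I]
    ring
  have hfun : ∀ x : ℝ, ((Real.sqrt (2 / a) * Real.cos (n * π * x / a) : ℝ) : ℂ) *
          Complex.exp (-Complex.I * ((k : ℂ) - Complex.I * lam) * x) =
      (Real.sqrt (2 / a) : ℂ) * (Complex.cos (p * x) *
          Complex.exp (-Complex.I * ((k : ℂ) - Complex.I * lam) * x)) := by
    intro x
    have : (n : ℝ) * π * x / a = p * x := by rw [hp]; ring
    rw [this]; push_cast; ring
  simp_rw [hfun]
  rw [intervalIntegral.integral_const_mul, hI, ← Complex.ofReal_mul p, ← Complex.ofReal_sin]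
  simp only [norm_mul, norm_div, mul_pow, div_pow, hDn, hC, Complex.norm_real, Real.norm_eq_abs,
    sq_abs, hs]
  rw [Real.sq_sqrt (by positivity)]
  have hpp : π ^ 2 * n ^ 2 / a ^ 2 = p ^ 2 := by rw [hp]; ring
  rw [hpp]
  have hn2 : (n : ℝ) = p * a / π := by rw [hp]; field_simp
  rw [hn2]
  simp only [Complex.norm_ofNat]
  field_simp
  try ring
end

section
/- Let a > 0 and let n be a positive integer. For every real k and every real λ ≠ 0, the spectral density ρ_n(k,λ) = (1/(2π))·|∫_{-∞}^∞ ψ_n(x)·exp(-i·(k - iλ)·x) dx|² is strictly positive. -/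
open MeasureTheory Real Complex

/-- The `n`-th stationary state of a particle in an infinitely deep potential well of
width `a`: `ψ n x = √(2/a)·cos(nπx/a)` for `|x| ≤ a/2` and odd `n`,
`ψ n x = √(2/a)·sin(nπx/a)` for `|x| ≤ a/2` and even `n`, and `0` for `|x| > a/2`. -/
noncomputable def wellState (a : ℝ) (n : ℕ) (x : ℝ) : ℝ :=
  if |x| ≤ a / 2 then
    if Odd n then Real.sqrt (2 / a) * Real.cos (n * π * x / a)
    else Real.sqrt (2 / a) * Real.sin (n * π * x / a)
  else 0

lemma aux_int (f g : ℝ → ℝ) (w h : ℝ) (c : ℂ) (hh : 0 < h) (hc : c.re ≠ 0)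
    (hf : ∀ x, HasDerivAt f (g x) x) (hg : ∀ x, HasDerivAt g (-w ^ 2 * f x) x)
    (h1 : f h = 0) (h2 : f (-h) = 0) (h3 : |g (-h)| = |g h|) (h4 : g h ≠ 0) :
    (∫ x in (-h)..h, (f x : ℂ) * Complex.exp (c * x)) ≠ 0 := by
  intro h0
  have hfc : Continuous f := continuous_iff_continuousAt.2 fun x => (hf x).continuousAt
  have hd : ∀ x : ℝ, HasDerivAt (fun x : ℝ => Complex.exp (c * x) * (c * f x - g x))
      ((c ^ 2 + w ^ 2) * ((f x : ℂ) * Complex.exp (c * x))) x := by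
    intro x
    have e1 : HasDerivAt (fun x : ℝ => Complex.exp (c * x)) (Complex.exp (c * x) * (c * 1)) x :=
      ((Complex.ofRealCLM.hasDerivAt (x := x)).const_mul c).cexp
    have e2 := ((hf x).ofReal_comp.const_mul c).sub (hg x).ofReal_comp
    refine (e1.mul e2).congr_deriv ?_
    push_cast
    simp only [Pi.sub_apply]
    ring
  have hI := intervalIntegral.integral_eq_sub_of_hasDerivAt (a := -h) (b := h)
    (fun x _ => hd x) (by
      apply Continuous.intervalIntegrable
      fun_prop)
  rw [intervalIntegral.integral_const_mul, h0, mul_zero, h1, h2] at hI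
  have hE := congrArg norm (sub_eq_zero.1 hI.symm)
  simp only [Complex.ofReal_zero, mul_zero, zero_sub, norm_mul, norm_neg, Complex.norm_real,
    Real.norm_eq_abs, h3, Complex.norm_exp] at hE
  have hE2 := Real.exp_injective (mul_right_cancel₀ (abs_ne_zero.2 h4) hE)
  simp at hE2
  have : c.re * h = 0 := by linarith
  exact (mul_ne_zero hc hh.ne') this

lemma aux_trig (n : ℕ) : (Odd n → Real.cos (n * π / 2) = 0) ∧
    (¬ Odd n → Real.sin (n * π / 2) = 0) := by
  constructor
  · rintro ⟨m, rfl⟩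
    rw [Real.cos_eq_zero_iff]
    exact ⟨m, by push_cast; ring⟩
  · intro h
    obtain ⟨m, rfl⟩ := Nat.not_odd_iff_even.1 h
    rw [Real.sin_eq_zero_iff]
    exact ⟨m, by push_cast; ring⟩

theorem stmt_16 (a : ℝ) (ha : 0 < a) (n : ℕ) (hn : 0 < n) (k lam : ℝ) (hlam : lam ≠ 0) :
    0 < 1 / (2 * π) *
      ‖(∫ x : ℝ, (wellState a n x : ℂ) *
        Complex.exp (-Complex.I * ((k : ℂ) - Complex.I * lam) * x))‖ ^ 2 := by
  suffices H : (∫ x : ℝ, (wellState a n x : ℂ) *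
        Complex.exp (-Complex.I * ((k : ℂ) - Complex.I * lam) * x)) ≠ 0 by
    have := norm_pos_iff.2 H
    positivity
  set c : ℂ := -Complex.I * ((k : ℂ) - Complex.I * lam) with hcdef
  have hc : c.re ≠ 0 := by simpa [hcdef] using hlam
  have hs : Real.sqrt (2 / a) ≠ 0 := by positivity
  have hw : (n * π / a : ℝ) ≠ 0 := by positivity
  set w : ℝ := n * π / a with hwdef
  have hwa : w * (a / 2) = n * π / 2 := by rw [hwdef]; field_simp
  have key : ∀ f : ℝ → ℝ, (∀ x, wellState a n x = if |x| ≤ a / 2 then f x else 0) →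
      (∫ x : ℝ, (wellState a n x : ℂ) * Complex.exp (c * x)) =
      ∫ x in (-(a/2))..(a/2), (f x : ℂ) * Complex.exp (c * x) := by
    intro f hf
    rw [intervalIntegral.integral_of_le (by linarith), ← integral_Icc_eq_integral_Ioc,
      ← integral_indicator measurableSet_Icc]
    congr 1
    ext x
    rw [hf x]
    by_cases hx : |x| ≤ a / 2
    · rw [if_pos hx, Set.indicator_of_mem (Set.mem_Icc.2 (abs_le.1 hx))]
    · rw [if_neg hx, Set.indicator_of_notMem (fun h => hx (abs_le.2 (Set.mem_Icc.1 h)))]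
      simp
  have hlin : ∀ x : ℝ, HasDerivAt (fun x : ℝ => w * x) w x := fun x => by
    simpa using (hasDerivAt_id x).const_mul w
  have hsc := Real.sin_sq_add_cos_sq (n * π / 2)
  by_cases ho : Odd n
  · rw [key (fun x => Real.sqrt (2 / a) * Real.cos (w * x)) (fun x => by
      simp only [wellState, if_pos ho, hwdef]; congr 3; ring)]
    have hz := (aux_trig n).1 ho
    refine aux_int _ (fun x => Real.sqrt (2 / a) * (-Real.sin (w * x) * w)) w (a / 2) c
      (by positivity) hc (fun x => (hlin x).cos.const_mul _) (fun x => ?_) ?_ ?_ ?_ ?_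
    · exact (((hlin x).sin.neg.mul_const w).const_mul _).congr_deriv (by ring)
    · simp only [hwa, hz, mul_zero]
    · simp only [mul_neg, Real.cos_neg, hwa, hz, mul_zero]
    · simp [abs_mul]
    · simp only [hwa]
      refine mul_ne_zero hs (mul_ne_zero (neg_ne_zero.2 fun h => ?_) hw)
      rw [h, hz] at hsc; norm_num at hsc
  · rw [key (fun x => Real.sqrt (2 / a) * Real.sin (w * x)) (fun x => by
      simp only [wellState, if_neg ho, hwdef]; congr 3; ring)]
    have hz := (aux_trig n).2 ho
    refine aux_int _ (fun x => Real.sqrt (2 / a) * (Real.cos (w * x) * w)) w (a / 2) c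
      (by positivity) hc (fun x => (hlin x).sin.const_mul _) (fun x => ?_) ?_ ?_ ?_ ?_
    · exact (((hlin x).cos.mul_const w).const_mul _).congr_deriv (by ring)
    · simp only [hwa, hz, mul_zero]
    · simp only [mul_neg, Real.sin_neg, hwa, hz, mul_zero, neg_zero]
    · simp [abs_mul]
    · simp only [hwa]
      refine mul_ne_zero hs (mul_ne_zero (fun h => ?_) hw)
      rw [h, hz] at hsc; norm_num at hsc
end
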